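/- arXiv:2003.03506 — 2 statements merged into one kernel-verified Lean document; each statement's English description precedes it below -/
import Mathlib

section
/- Let g, u be real numbers with u ≥ 0 and h > 0, and let φ(t) = g·(t − u) + (h/2)·(t − u)². Let t* = max(0, u − g/h). Then φ(t*) = −g²/(2h) if u ≥ g/h, and φ(t*) = −g·u + (h/2)·u² if u < g/h; in either case φ(t*) ≤ 0. -/
/-- Exact decrease of the single-coordinate quadratic model at the projected Newton step
t* = max 0 (u − g/h): it equals −g²/(2h) if u ≥ g/h and −gu + (h/2)u² otherwise, and is
nonpositive in either case. -/
theorem cutcd_step_model_value (g u h : ℝ) (hu : 0 ≤ u) (hh : 0 < h) :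
    let φ : ℝ → ℝ := fun t => g * (t - u) + (h / 2) * (t - u) ^ 2
    let tstar : ℝ := max 0 (u - g / h)
    (g / h ≤ u → φ tstar = -(g ^ 2) / (2 * h)) ∧
    (u < g / h → φ tstar = -(g * u) + (h / 2) * u ^ 2) ∧
    φ tstar ≤ 0 := by
  intro φ tstar
  have interior (hle : g / h ≤ u) : φ tstar = -(g ^ 2) / (2 * h) := by
    simp only [φ, tstar, max_eq_right (sub_nonneg.2 hle)]
    field_simp
    ring
  have boundary (hlt : u < g / h) : φ tstar = -(g * u) + (h / 2) * u ^ 2 := by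
    simp only [φ, tstar, max_eq_left (sub_nonpos.2 hlt.le)]
    ring
  refine ⟨interior, boundary, ?_⟩
  rcases le_or_gt (g / h) u with hle | hlt
  · rw [interior hle]
    exact div_nonpos_of_nonpos_of_nonneg (neg_nonpos.2 (sq_nonneg g)) (by positivity)
  · rw [boundary hlt]
    have huh : u * h < g := (lt_div_iff₀ hh).1 hlt
    nlinarith [mul_nonneg hu (sub_nonneg.2 huh.le), mul_nonneg hh.le (sq_nonneg u)]
end

section
/- Let X₁ be a J × N real matrix, Y a J × M real matrix, B an N × R real matrix and C an M × R real matrix, and define f(U) = ‖X₁ − U Bᵀ‖² + ‖Y − U Cᵀ‖² for J × R real matrices U (squared Frobenius norms). Fix U and indices j ∈ Fin J, r ∈ Fin R, set g = (U BᵀB − X₁ B + U CᵀC − Y C)_{j r} and h = (BᵀB)_{r r} + (CᵀC)_{r r}, and assume h > 0. Then t* = max(0, U_{j r} − g/h) minimizes the function t ↦ f(U with (j,r) entry replaced by t) over all t ≥ 0. -/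
open scoped BigOperators
open Matrix

/-- Squared Frobenius norm: sum of squares of the entries. -/
def frobSq {m n : Type*} [Fintype m] [Fintype n] (A : Matrix m n ℝ) : ℝ :=
  ∑ i, ∑ j, A i j ^ 2

/-- Replace the (j,r) entry of U by v. -/
def updEntry {J R : ℕ} (U : Matrix (Fin J) (Fin R) ℝ) (j : Fin J) (r : Fin R) (v : ℝ) :
    Matrix (Fin J) (Fin R) ℝ :=
  Matrix.of fun a b => if a = j ∧ b = r then v else U a b

theorem updEntry_eq_add_single {J R : ℕ} (U : Matrix (Fin J) (Fin R) ℝ) (j : Fin J) (r : Fin R)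
    (v : ℝ) : updEntry U j r v = U + Matrix.single j r (v - U j r) := by
  ext a b
  by_cases hab : a = j ∧ b = r
  · obtain ⟨rfl, rfl⟩ := hab
    simp [updEntry]
  · have hba : ¬ (j = a ∧ r = b) := fun h => hab ⟨h.1.symm, h.2.symm⟩
    simp [updEntry, hab, hba]

/-- The squared Frobenius residual is a quadratic polynomial in a single entry of `U`. -/
theorem frobSq_sub_updEntry_mul_transpose {J N R : ℕ} (X : Matrix (Fin J) (Fin N) ℝ)
    (B : Matrix (Fin N) (Fin R) ℝ) (U : Matrix (Fin J) (Fin R) ℝ) (j : Fin J) (r : Fin R)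
    (v : ℝ) :
    frobSq (X - updEntry U j r v * Bᵀ) = frobSq (X - U * Bᵀ)
      + 2 * (v - U j r) * (U * Bᵀ * B - X * B) j r + (v - U j r) ^ 2 * (Bᵀ * B) r r := by
  have entry (i : Fin J) (k : Fin N) : (X - updEntry U j r v * Bᵀ) i k
      = (X - U * Bᵀ) i k - if i = j then (v - U j r) * B k r else 0 := by
    rw [updEntry_eq_add_single, Matrix.add_mul, ← sub_sub, Matrix.sub_apply]
    congr 1
    split_ifs with hij
    · subst hij
      simp
    · simp [hij]
  have row (i : Fin J) : ∑ k, (X - updEntry U j r v * Bᵀ) i k ^ 2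
      = ∑ k, (X - U * Bᵀ) i k ^ 2 + if i = j then
        2 * (v - U j r) * (U * Bᵀ * B - X * B) j r + (v - U j r) ^ 2 * (Bᵀ * B) r r else 0 := by
    simp only [entry]
    split_ifs with hij
    · subst hij
      rw [← Matrix.sub_mul, Matrix.mul_apply, Matrix.mul_apply, Finset.mul_sum, Finset.mul_sum,
        ← Finset.sum_add_distrib, ← Finset.sum_add_distrib]
      refine Finset.sum_congr rfl fun k _ => ?_
      simp only [Matrix.sub_apply, Matrix.transpose_apply]
      ring
    · simp
  unfold frobSq
  simp only [row, Finset.sum_add_distrib, Finset.sum_ite_eq', Finset.mem_univ, if_true]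
  ring

/-- Projecting the vertex of a convex quadratic to the half-line minimizes it there. -/
theorem quadratic_max_zero_le {g h u t : ℝ} (hh : 0 < h) (ht : 0 ≤ t) :
    2 * (max 0 (u - g / h) - u) * g + (max 0 (u - g / h) - u) ^ 2 * h
      ≤ 2 * (t - u) * g + (t - u) ^ 2 * h := by
  obtain ⟨q, rfl⟩ : ∃ q, g = q * h := ⟨g / h, by field_simp⟩
  rw [mul_div_cancel_right₀ q hh.ne']
  suffices H : (max 0 (u - q) - (u - q)) ^ 2 ≤ (t - (u - q)) ^ 2 by
    nlinarith [mul_le_mul_of_nonneg_right H hh.le]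
  rcases le_total 0 (u - q) with hq | hq
  · rw [max_eq_right hq]
    nlinarith [sq_nonneg (t - (u - q))]
  · rw [max_eq_left hq]
    nlinarith [mul_nonneg ht (neg_nonneg.mpr hq)]

/-- The coordinate-descent update t* = max(0, U_{j r} − g/h) minimizes the N-CMTF objective
restricted to the single nonnegative coordinate (j,r). -/
theorem coordinate_update_minimizes {J N M R : ℕ}
    (X₁ : Matrix (Fin J) (Fin N) ℝ) (Y : Matrix (Fin J) (Fin M) ℝ)
    (B : Matrix (Fin N) (Fin R) ℝ) (C : Matrix (Fin M) (Fin R) ℝ)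
    (U : Matrix (Fin J) (Fin R) ℝ) (j : Fin J) (r : Fin R) :
    let f : Matrix (Fin J) (Fin R) ℝ → ℝ :=
      fun A => frobSq (X₁ - A * Bᵀ) + frobSq (Y - A * Cᵀ)
    let g : ℝ := (U * Bᵀ * B - X₁ * B + U * Cᵀ * C - Y * C) j r
    let h : ℝ := (Bᵀ * B) r r + (Cᵀ * C) r r
    0 < h →
    ∀ t : ℝ, 0 ≤ t →
      f (updEntry U j r (max 0 (U j r - g / h))) ≤ f (updEntry U j r t) := by
  intro f g h hh t ht
  have key (v : ℝ) : f (updEntry U j r v) = f U + (2 * (v - U j r) * g + (v - U j r) ^ 2 * h) := by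
    simp only [f, g, h, frobSq_sub_updEntry_mul_transpose, Matrix.sub_apply, Matrix.add_apply]
    ring
  rw [key, key]
  gcongr f U + ?_
  exact quadratic_max_zero_le hh ht
end
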